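/- arXiv:2502.01851 — 3 statements merged into one kernel-verified Lean document; each statement's English description precedes it below -/
import Mathlib

section
/- For every integer k ≥ 0, the space (P_k(ℝ³))³ of polynomial vector fields of total degree at most k on ℝ³ is the internal direct sum of G_k := {∇φ : φ ∈ P_{k+1}(ℝ³)} and G_k^⊕ := {x ↦ x ∧ q(x) : q ∈ (P_{k-1}(ℝ³))³}; that is, G_k ∩ G_k^⊕ = {0} and every p ∈ (P_k(ℝ³))³ can be written as p = ∇φ + (x ↦ x ∧ q(x)) with φ ∈ P_{k+1}(ℝ³) and q ∈ (P_{k-1}(ℝ³))³. -/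
open Matrix

/-- `PolyDeg k` : real polynomial functions `ℝ³ → ℝ` of total degree at most `k`
(with the convention that `PolyDeg k = {0}` for `k < 0`, in particular `P_{-1} = {0}`). -/
def PolyDeg (k : ℤ) : Set ((Fin 3 → ℝ) → ℝ) :=
  {f | ∃ P : MvPolynomial (Fin 3) ℝ,
    (∀ m ∈ P.support, ((m.sum fun _ e => e : ℕ) : ℤ) ≤ k) ∧
    ∀ x, f x = MvPolynomial.eval x P}

/-- `PolyVec k` : vector fields `ℝ³ → ℝ³` whose three components lie in `PolyDeg k`. -/
def PolyVec (k : ℤ) : Set ((Fin 3 → ℝ) → (Fin 3 → ℝ)) :=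
  {v | ∀ i : Fin 3, (fun x => v x i) ∈ PolyDeg k}

/-- The gradient of a scalar field on `ℝ³`, via directional derivatives along the
standard basis. -/
noncomputable def grad3 (φ : (Fin 3 → ℝ) → ℝ) (x : Fin 3 → ℝ) : Fin 3 → ℝ :=
  fun i => fderiv ℝ φ x (Pi.single i 1)

/-- The space `G_k = ∇ P_{k+1}` of gradients of polynomials of degree ≤ k+1. -/
noncomputable def Gspace (k : ℤ) : Set ((Fin 3 → ℝ) → (Fin 3 → ℝ)) :=
  {w | ∃ φ ∈ PolyDeg (k + 1), w = fun x => grad3 φ x}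

/-- The complement space `G_k^⊕ = x ∧ (P_{k-1})³`. -/
def GspaceOplus (k : ℤ) : Set ((Fin 3 → ℝ) → (Fin 3 → ℝ)) :=
  {w | ∃ q ∈ PolyVec (k - 1), w = fun x => crossProduct x (q x)}

namespace MvPolynomial

theorem coeff_X_mul_pderiv {σ R : Type*} [CommSemiring R] (i : σ) (P : MvPolynomial σ R)
    (m : σ →₀ ℕ) : coeff m (X i * pderiv i P) = m i * coeff m P := by
  classical
  induction P using MvPolynomial.induction_on' with
  | add p q hp hq => simp only [map_add, mul_add, coeff_add, hp, hq]
  | monomial n a =>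
    rw [X_mul_pderiv_monomial, coeff_smul, coeff_monomial, nsmul_eq_mul]
    split_ifs with h
    · rw [h]
    · simp

/-- The Euler operator multiplies the coefficient of a monomial by its degree. -/
theorem coeff_sum_X_mul_pderiv {σ R : Type*} [Fintype σ] [CommSemiring R]
    (P : MvPolynomial σ R) (m : σ →₀ ℕ) :
    coeff m (∑ i, X i * pderiv i P) = m.degree * coeff m P := by
  simp only [coeff_sum, coeff_X_mul_pderiv, ← Finset.sum_mul, Finsupp.degree_eq_sum,
    Nat.cast_sum]

/-- A polynomial killed by the Euler operator is constant. -/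
theorem pderiv_eq_zero_of_sum_X_mul_pderiv_eq_zero {σ R : Type*} [Fintype σ] [CommRing R]
    [IsDomain R] [CharZero R] {P : MvPolynomial σ R} (h : ∑ i, X i * pderiv i P = 0) (j : σ) :
    pderiv j P = 0 := by
  ext m
  have hm := coeff_sum_X_mul_pderiv P (m + Finsupp.single j 1)
  rw [h, coeff_zero, eq_comm, mul_eq_zero] at hm
  have hd : ((m + Finsupp.single j 1).degree : R) ≠ 0 := by
    rw [Nat.cast_ne_zero, map_add, Finsupp.degree_single]
    omega
  rw [coeff_pderiv, hm.resolve_left hd, zero_mul, coeff_zero]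

theorem exists_coeff_eq_mul {σ R : Type*} [CommSemiring R] (P : MvPolynomial σ R)
    (a : (σ →₀ ℕ) → R) : ∃ S : MvPolynomial σ R, ∀ m, coeff m S = a m * coeff m P := by
  classical
  refine ⟨∑ n ∈ P.support, monomial n (a n * coeff n P), fun m => ?_⟩
  simp only [coeff_sum, coeff_monomial, Finset.sum_ite_eq', mem_support_iff]
  split_ifs with h
  · rfl
  · rw [not_not.1 h, mul_zero]

/-- The operator `1 + ∑ i, X i ∂ᵢ` is surjective, through division of coefficients. -/
theorem exists_add_sum_X_mul_pderiv_eq {σ K : Type*} [Fintype σ] [Field K] [CharZero K]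
    (P : MvPolynomial σ K) :
    ∃ S : MvPolynomial σ K, S.support ⊆ P.support ∧ S + ∑ i, X i * pderiv i S = P := by
  obtain ⟨S, hS⟩ := exists_coeff_eq_mul P fun m => ((m.degree : K) + 1)⁻¹
  refine ⟨S, fun m hm => ?_, ?_⟩
  · rw [mem_support_iff, hS] at hm
    exact mem_support_iff.2 (right_ne_zero_of_mul hm)
  · ext m
    have hd : (m.degree : K) + 1 ≠ 0 := Nat.cast_add_one_ne_zero _
    rw [coeff_add, coeff_sum_X_mul_pderiv, hS]
    field_simp
    ring

theorem hasFDerivAt_eval {ι : Type*} [Fintype ι] (P : MvPolynomial ι ℝ) (x : ι → ℝ) :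
    HasFDerivAt (fun y => eval y P)
      (∑ i, eval x (pderiv i P) • ContinuousLinearMap.proj (R := ℝ) (φ := fun _ : ι => ℝ) i)
      x := by
  classical
  induction P using MvPolynomial.induction_on with
  | C a => simpa using hasFDerivAt_const a x
  | add p q hp hq =>
    simp only [map_add, add_smul, Finset.sum_add_distrib]
    exact hp.add hq
  | mul_X p j hp =>
    have hj : HasFDerivAt (fun y : ι → ℝ => y j)
        (ContinuousLinearMap.proj (R := ℝ) (φ := fun _ : ι => ℝ) j) x := hasFDerivAt_apply j x
    have := hp.mul hj
    simp only [map_mul, eval_X]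
    refine this.congr_fderiv ?_
    ext v
    simp [Pi.single_apply, add_mul, Finset.sum_add_distrib, Finset.mul_sum, apply_ite, ite_mul]
    exact Finset.sum_congr rfl fun i _ => by ring

end MvPolynomial

open MvPolynomial in
theorem grad3_eval (P : MvPolynomial (Fin 3) ℝ) (x : Fin 3 → ℝ) (i : Fin 3) :
    grad3 (fun y => eval y P) x i = eval x (pderiv i P) := by
  simp [grad3, (hasFDerivAt_eval P x).fderiv, Pi.single_apply]

namespace PolyDeg

open MvPolynomial

theorem mem_iff {k : ℤ} {f : (Fin 3 → ℝ) → ℝ} :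
    f ∈ PolyDeg k ↔ ∃ P : MvPolynomial (Fin 3) ℝ,
      (∀ m, coeff m P ≠ 0 → (m.degree : ℤ) ≤ k) ∧ f = fun x => eval x P := by
  simp only [PolyDeg, Set.mem_ofPred_eq, mem_support_iff, _root_.funext_iff]
  rfl

theorem zero_mem (k : ℤ) : (fun _ => 0) ∈ PolyDeg k :=
  mem_iff.2 ⟨0, by simp, by simp⟩

theorem add_mem {k : ℤ} {f g : (Fin 3 → ℝ) → ℝ} (hf : f ∈ PolyDeg k) (hg : g ∈ PolyDeg k) :
    (fun x => f x + g x) ∈ PolyDeg k := by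
  obtain ⟨P, hP, rfl⟩ := mem_iff.1 hf
  obtain ⟨Q, hQ, rfl⟩ := mem_iff.1 hg
  refine mem_iff.2 ⟨P + Q, fun m hm => ?_, by simp⟩
  by_cases h : coeff m P = 0
  · exact hQ m fun h' => hm (by simp [h, h'])
  · exact hP m h

theorem sub_mem {k : ℤ} {f g : (Fin 3 → ℝ) → ℝ} (hf : f ∈ PolyDeg k) (hg : g ∈ PolyDeg k) :
    (fun x => f x - g x) ∈ PolyDeg k := by
  obtain ⟨Q, hQ, rfl⟩ := mem_iff.1 hg
  have : (fun x => -eval x Q) ∈ PolyDeg k := mem_iff.2 ⟨-Q, by simpa using hQ, by simp⟩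
  simpa only [sub_eq_add_neg] using add_mem hf this

theorem sum_mem {k : ℤ} {ι : Type*} (s : Finset ι) {f : ι → (Fin 3 → ℝ) → ℝ}
    (hf : ∀ i ∈ s, f i ∈ PolyDeg k) : (fun x => ∑ i ∈ s, f i x) ∈ PolyDeg k := by
  classical
  induction s using Finset.induction_on with
  | empty => simpa using zero_mem k
  | insert a s ha ih =>
    simp only [Finset.sum_insert ha]
    exact add_mem (hf a (Finset.mem_insert_self a s))
      (ih fun i hi => hf i (Finset.mem_insert_of_mem hi))

theorem eval_X_mul_mem {k : ℤ} {P : MvPolynomial (Fin 3) ℝ}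
    (hP : ∀ m, coeff m P ≠ 0 → (m.degree : ℤ) ≤ k) (i : Fin 3) :
    (fun x => x i * eval x P) ∈ PolyDeg (k + 1) := by
  refine mem_iff.2 ⟨X i * P, fun m hm => ?_, by simp⟩
  rw [← mem_support_iff, support_X_mul, Finset.mem_map] at hm
  obtain ⟨n, hn, rfl⟩ := hm
  have := hP n (mem_support_iff.1 hn)
  simp only [addLeftEmbedding_apply, map_add, Finsupp.degree_single]
  push_cast
  linarith

theorem eval_pderiv_mem {k : ℤ} {P : MvPolynomial (Fin 3) ℝ}
    (hP : ∀ m, coeff m P ≠ 0 → (m.degree : ℤ) ≤ k) (i : Fin 3) :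
    (fun x => eval x (pderiv i P)) ∈ PolyDeg (k - 1) := by
  refine mem_iff.2 ⟨pderiv i P, fun m hm => ?_, rfl⟩
  rw [coeff_pderiv] at hm
  have := hP _ (left_ne_zero_of_mul hm)
  rw [map_add, Finsupp.degree_single] at this
  push_cast at this
  linarith

end PolyDeg

theorem Gspace_inter_GspaceOplus (k : ℤ) : Gspace k ∩ GspaceOplus k = {0} := by
  refine Set.Subset.antisymm ?_ ?_
  · rintro w ⟨⟨φ, hφ, rfl⟩, q, -, hq⟩
    obtain ⟨P, -, rfl⟩ := PolyDeg.mem_iff.1 hφ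
    have hP : ∑ i, MvPolynomial.X i * MvPolynomial.pderiv i P = 0 := by
      refine MvPolynomial.funext fun x => ?_
      have hx : x ⬝ᵥ grad3 (fun y => MvPolynomial.eval y P) x = 0 := by
        rw [congrFun hq x, dot_self_cross]
      simpa [dotProduct, grad3_eval] using hx
    ext x i
    simp [grad3_eval, MvPolynomial.pderiv_eq_zero_of_sum_X_mul_pderiv_eq_zero hP i]
  · rintro w rfl
    refine ⟨⟨fun _ => 0, PolyDeg.zero_mem _, ?_⟩, fun _ => 0, fun _ => PolyDeg.zero_mem _, ?_⟩
    · ext x i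
      simp [grad3]
    · ext x i
      simp

/-- For every integer `k ≥ 0`, `(P_k)³ = G_k ⊕ G_k^⊕`: the intersection is trivial and
every polynomial vector field of degree ≤ k decomposes as `∇φ + x ∧ q` with
`φ ∈ P_{k+1}` and `q ∈ (P_{k-1})³`. -/
theorem statement0 (k : ℕ) :
    Gspace k ∩ GspaceOplus k = {0} ∧
    ∀ p ∈ PolyVec k, ∃ φ ∈ PolyDeg ((k : ℤ) + 1), ∃ q ∈ PolyVec ((k : ℤ) - 1),
      ∀ x, p x = grad3 φ x + crossProduct x (q x) := by
  refine ⟨Gspace_inter_GspaceOplus k, fun p hp => ?_⟩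
  choose P hP hpP using fun i => PolyDeg.mem_iff.1 (hp i)
  choose S hSP hS using fun i => MvPolynomial.exists_add_sum_X_mul_pderiv_eq (P i)
  have hSk : ∀ i m, MvPolynomial.coeff m (S i) ≠ 0 → (m.degree : ℤ) ≤ k := fun i m hm =>
    hP i m (MvPolynomial.mem_support_iff.1 (hSP i (MvPolynomial.mem_support_iff.2 hm)))
  let D (i j : Fin 3) (x : Fin 3 → ℝ) : ℝ := MvPolynomial.eval x (MvPolynomial.pderiv i (S j))
  have hD : ∀ i j, D i j ∈ PolyDeg ((k : ℤ) - 1) := fun i j =>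
    PolyDeg.eval_pderiv_mem (hSk j) i
  -- The potential is `x ⬝ S`, and `q = -curl S`.
  refine ⟨fun x => ∑ i, x i * MvPolynomial.eval x (S i),
    PolyDeg.sum_mem _ fun i _ => PolyDeg.eval_X_mul_mem (hSk i) i,
    fun x => ![D 2 1 x - D 1 2 x, D 0 2 x - D 2 0 x, D 1 0 x - D 0 1 x], ?_, fun x => ?_⟩
  · intro i
    fin_cases i
    · exact PolyDeg.sub_mem (hD 2 1) (hD 1 2)
    · exact PolyDeg.sub_mem (hD 0 2) (hD 2 0)
    · exact PolyDeg.sub_mem (hD 1 0) (hD 0 1)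
  · have hφ : (fun x : Fin 3 → ℝ => ∑ i, x i * MvPolynomial.eval x (S i)) =
        fun x => MvPolynomial.eval x (∑ i, MvPolynomial.X i * S i) := by
      simp
    ext i
    rw [congrFun (hpP i) x, ← hS i, hφ, Pi.add_apply, grad3_eval, cross_apply]
    fin_cases i <;>
      simp [D, Fin.sum_univ_three] <;> ring
end

section
/- Let k ≥ 0, φ ∈ P_{k+1}(ℝ³) and q ∈ (P_{k-1}(ℝ³))³. If ∇φ(x) = x ∧ q(x) for all x ∈ ℝ³, then ∇φ ≡ 0 (equivalently, φ is constant and x ∧ q(x) = 0 for all x). -/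
open Matrix

theorem PolyDeg.differentiable {k : ℤ} {f : (Fin 3 → ℝ) → ℝ} (hf : f ∈ PolyDeg k) :
    Differentiable ℝ f := by
  obtain ⟨P, -, hP⟩ := hf
  rw [funext hP]
  exact differentiableOn_univ.mp (AnalyticOnNhd.eval_mvPolynomial P).differentiableOn

theorem fderiv_eq_dotProduct_grad3 (φ : (Fin 3 → ℝ) → ℝ) (x v : Fin 3 → ℝ) :
    fderiv ℝ φ x v = v ⬝ᵥ grad3 φ x := by
  conv_lhs => rw [pi_eq_sum_univ' v]
  simp [dotProduct, grad3]

/-- A differentiable function on a real normed space whose radial derivative vanishes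
everywhere, and whose derivative vanishes at the origin, is constant. -/
theorem eq_apply_zero_of_fderiv_radial_eq_zero {E : Type*} [NormedAddCommGroup E]
    [NormedSpace ℝ E] {f : E → ℝ} (hf : Differentiable ℝ f)
    (h : ∀ x, fderiv ℝ f x x = 0) (h0 : fderiv ℝ f 0 = 0) (x : E) : f x = f 0 := by
  have hderiv (t : ℝ) : HasDerivAt (fun s : ℝ => f (s • x)) (fderiv ℝ f (t • x) x) t := by
    have hline : HasDerivAt (fun s : ℝ => s • x) x t := by
      simpa using (hasDerivAt_id t).smul_const x
    exact (hf (t • x)).hasFDerivAt.comp_hasDerivAt t hline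
  have hzero (t : ℝ) : fderiv ℝ f (t • x) x = 0 := by
    rcases eq_or_ne t 0 with rfl | ht
    · simp [h0]
    · simpa [ht] using h (t • x)
  simpa using is_const_of_deriv_eq_zero (fun t => (hderiv t).differentiableAt)
    (fun t => (hderiv t).deriv.trans (hzero t)) 1 0

/-- Trivial intersection of `G_k = ∇P_{k+1}` and `G_k^⊕ = x ∧ (P_{k-1})³`:
if `∇φ(x) = x ∧ q(x)` for all `x`, with `φ ∈ P_{k+1}` and `q ∈ (P_{k-1})³`,
then `∇φ ≡ 0`. -/
theorem statement1 (k : ℕ) (φ : (Fin 3 → ℝ) → ℝ) (q : (Fin 3 → ℝ) → (Fin 3 → ℝ))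
    (hφ : φ ∈ PolyDeg ((k : ℤ) + 1)) (hq : q ∈ PolyVec ((k : ℤ) - 1))
    (h : ∀ x, grad3 φ x = crossProduct x (q x)) :
    ∀ x, grad3 φ x = 0 := by
  have hradial (x : Fin 3 → ℝ) : fderiv ℝ φ x x = 0 := by
    rw [fderiv_eq_dotProduct_grad3, h, dot_self_cross]
  have hzero : fderiv ℝ φ 0 = 0 := by
    ext1 v
    simp [fderiv_eq_dotProduct_grad3, h]
  have hconst : φ = fun _ => φ 0 :=
    funext (eq_apply_zero_of_fderiv_radial_eq_zero (PolyDeg.differentiable hφ) hradial hzero)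
  intro x
  ext i
  rw [hconst]
  simp [grad3]
end

section
/- Let k ≥ 0 and let q ∈ (P_k(ℝ³))³ be a polynomial vector field such that x ∧ q(x) = 0 for all x ∈ ℝ³. Then there exists a polynomial f ∈ P_{k-1}(ℝ³) such that q(x) = f(x) x for all x ∈ ℝ³. -/
open Matrix

namespace MvPolynomial

/-- Polynomials `P i` with `X i * P j = X j * P i` for all `i, j` are the multiples `X i * F` of
the variables by a common factor `F`. -/
theorem exists_forall_eq_X_mul {R σ : Type*} [CommRing R] [IsDomain R] [Nontrivial σ]
    {P : σ → MvPolynomial σ R} (h : ∀ i j, X i * P j = X j * P i) :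
    ∃ F : MvPolynomial σ R, ∀ i, P i = X i * F := by
  obtain ⟨i, j, hij⟩ := exists_pair_ne σ
  have hdvd : (X i : MvPolynomial σ R) ∣ X j * P i := ⟨P j, (h i j).symm⟩
  obtain ⟨F, hF⟩ := (X_prime.dvd_or_dvd hdvd).resolve_left
    fun hX => hij (X_dvd_X.mp hX)
  refine ⟨F, fun l => mul_left_cancel₀ (X_ne_zero i) ?_⟩
  rw [h i l, hF]
  ring

end MvPolynomial

/-- Kernel of the map `q ↦ (x ↦ x ∧ q(x))` on polynomial vector fields of degree ≤ k:
if `x ∧ q(x) = 0` for all `x`, then `q(x) = f(x) x` for some polynomial `f` of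
degree ≤ k − 1. -/
theorem statement5 (k : ℕ) (q : (Fin 3 → ℝ) → (Fin 3 → ℝ)) (hq : q ∈ PolyVec k)
    (h : ∀ x : Fin 3 → ℝ, crossProduct x (q x) = 0) :
    ∃ f ∈ PolyDeg ((k : ℤ) - 1), ∀ x, q x = f x • x := by
  choose P hdeg heval using hq
  have hP : ∀ i j, MvPolynomial.X i * P j = MvPolynomial.X j * P i := by
    intro i j
    refine MvPolynomial.funext fun x => ?_
    have hx := h x
    rw [cross_apply] at hx
    have h0 := congrFun hx 0
    have h1 := congrFun hx 1
    have h2 := congrFun hx 2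
    simp only [cons_val, Pi.zero_apply] at h0 h1 h2
    simp only [map_mul, MvPolynomial.eval_X, ← heval]
    fin_cases i <;> fin_cases j <;> simp <;> linarith
  obtain ⟨F, hF⟩ := MvPolynomial.exists_forall_eq_X_mul hP
  refine ⟨fun x => MvPolynomial.eval x F, ⟨F, fun m hm => ?_, fun _ => rfl⟩, fun x => ?_⟩
  · have hmem : Finsupp.single 0 1 + m ∈ (P 0).support := by
      rw [hF 0, MvPolynomial.mem_support_iff, MvPolynomial.coeff_X_mul]
      exact MvPolynomial.mem_support_iff.mp hm
    have hle := hdeg 0 _ hmem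
    rw [Finsupp.sum_add_index' (fun _ => rfl) (fun _ _ _ => rfl),
      Finsupp.sum_single_index rfl] at hle
    omega
  · ext i
    simp [heval i x, hF i, mul_comm]
end
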